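/- arXiv:2309.11302 — 2 statements merged into one kernel-verified Lean document; each statement's English description precedes it below -/
import Mathlib

section
/- For every Q > 0 and every ε ∈ (0,1) there exists κ₀ > 0 such that for every κ ≥ κ₀ the following holds: if u : ℝ → ℝ is differentiable on [0, 1] with u(0) ≥ −Q and u'(t) ≥ κ²/2 − u(t)² for all t ∈ [0, 1], then u(1) ≥ (1 − ε)·κ/√2. -/
/-- For κ large depending only on `Q` and `ε`, a solution of `u' ≥ κ²/2 - u²` on `[0,1]`
with `u 0 ≥ -Q` satisfies `u 1 ≥ (1-ε) κ / √2`. -/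
theorem riccati_recovery (Q ε : ℝ) (hQ : 0 < Q) (hε : ε ∈ Set.Ioo (0:ℝ) 1) :
    ∃ κ₀ > (0:ℝ), ∀ κ ≥ κ₀, ∀ u u' : ℝ → ℝ,
      (∀ t ∈ Set.Icc (0:ℝ) 1, HasDerivAt u (u' t) t) →
      u 0 ≥ -Q →
      (∀ t ∈ Set.Icc (0:ℝ) 1, u' t ≥ κ ^ 2 / 2 - (u t) ^ 2) →
      u 1 ≥ (1 - ε) * κ / Real.sqrt 2 := by
  obtain ⟨hε0, hε1⟩ := hε
  have h1ε : 0 < 1 - ε := by linarith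
  have hs : 0 < √(2 : ℝ) := by positivity
  refine ⟨√2 * (Q / (1 - ε) + 3 / ε), by positivity, fun κ hκ u u' hu hu0 hu' => ?_⟩
  obtain ⟨a, rfl⟩ : ∃ a, κ = √2 * a := ⟨κ / √2, by field_simp⟩
  have ha : Q / (1 - ε) + 3 / ε ≤ a := le_of_mul_le_mul_left hκ hs
  have hQ1 : 0 < Q / (1 - ε) := by positivity
  have h3 : 0 < 3 / ε := by positivity
  have haQ : Q ≤ (1 - ε) * a := by
    rw [← div_le_iff₀' h1ε]; linarith
  have haε : 3 ≤ ε * a := by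
    rw [← div_le_iff₀' hε0]; linarith
  have ha0 : 0 < a := by linarith
  have hsq : (√2 * a) ^ 2 / 2 = a ^ 2 := by
    rw [mul_pow, Real.sq_sqrt zero_le_two]; ring
  have hend : (1 - ε) * (√2 * a) / √2 = (1 - ε) * a := by field_simp
  rw [hend]
  rw [hsq] at hu'
  obtain ⟨L, hL⟩ : ∃ L, L = (1 - ε) * a := ⟨_, rfl⟩
  rw [← hL] at haQ ⊢
  have hLa : L ≤ a := by nlinarith
  have hgap : L + Q < a ^ 2 - L ^ 2 := by
    have hprod : 3 * a ≤ ε * a * a := by gcongr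
    have hfactor : a ^ 2 - L ^ 2 = ε * a * a + ε * a * L := by rw [hL]; ring
    have hrest : 0 ≤ ε * a * L := by
      have : 0 < L := by linarith
      positivity
    linarith
  -- Compare `u` with the affine function running from `-Q` at `0` to `L` at `1`.
  have key := image_le_of_deriv_right_lt_deriv_boundary'
    (f := fun t => -Q + (L + Q) * t) (f' := fun _ => L + Q) (a := 0) (b := 1)
    (by fun_prop)
    (fun x _ => by
      simpa using (((hasDerivAt_id x).const_mul (L + Q)).const_add (-Q)).hasDerivWithinAt)
    (B := u) (B' := u') (by simpa using hu0)
    (fun x hx => (hu x hx).continuousAt.continuousWithinAt)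
    (fun x hx => (hu x (Set.Ico_subset_Icc_self hx)).hasDerivWithinAt)
    (fun x hx hxu => by
      have hbound := hu' x (Set.Ico_subset_Icc_self hx)
      have hlow : -L ≤ u x := by
        have : 0 ≤ (L + Q) * x := mul_nonneg (by linarith) hx.1
        linarith
      have hupp : u x ≤ L := by
        have : (L + Q) * x ≤ L + Q := mul_le_of_le_one_right (by linarith) hx.2.le
        linarith
      have : u x ^ 2 ≤ L ^ 2 := sq_le_sq' hlow hupp
      linarith)
  have h1 := key (Set.right_mem_Icc.2 zero_le_one)
  simpa using h1
end

section
/- Let t₀ > 0 and let g : ℝ → ℝ be infinitely differentiable with g''(t) > 0 for all t ≥ t₀, g'(t₀) > 0, g(t₀) > 1, and g(t₀) − t₀·g'(t₀) < 1. Then there exists an infinitely differentiable function f : ℝ → ℝ such that f(t) = 1 for all t ≤ 0, f(t) = g(t) for all t ≥ t₀, and f''(t) ≥ 0 for all t ∈ ℝ. -/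
/-- A smooth function vanishing on `(-∞, u]` has a smooth antiderivative vanishing there. -/
theorem exists_contDiff_antideriv_eq_zero {h : ℝ → ℝ} {u : ℝ}
    (hh : ContDiff ℝ (⊤ : ℕ∞) h) (h0 : ∀ t ≤ u, h t = 0) :
    ∃ F : ℝ → ℝ, ContDiff ℝ (⊤ : ℕ∞) F ∧ (∀ t, HasDerivAt F (h t) t) ∧ ∀ t ≤ u, F t = 0 := by
  have hd : ∀ t, HasDerivAt (fun t => ∫ x in u..t, h x) (h t) t := fun t =>
    (hh.continuous.integral_hasStrictDerivAt u t).hasDerivAt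
  refine ⟨fun t => ∫ x in u..t, h x, ?_, hd, fun t ht => ?_⟩
  · rw [contDiff_infty_iff_deriv]
    refine ⟨fun t => (hd t).differentiableAt, ?_⟩
    rwa [show deriv (fun t => ∫ x in u..t, h x) = h from funext fun t => (hd t).deriv]
  · refine intervalIntegral.integral_zero_ae (Filter.Eventually.of_forall fun x hx => h0 x ?_)
    rw [Set.uIoc_of_ge ht] at hx
    exact hx.2

/-- Functions with the same derivative on `[a, ∞)` have the same increments there. -/
theorem sub_eq_sub_of_hasDerivAt_Ici {F G f : ℝ → ℝ} {a : ℝ}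
    (hF : ∀ t ≥ a, HasDerivAt F (f t) t) (hG : ∀ t ≥ a, HasDerivAt G (f t) t)
    {t : ℝ} (ht : a ≤ t) : F t - F a = G t - G a := by
  have hd : ∀ x ≥ a, HasDerivAt (fun x => F x - G x) 0 x := fun x hx => by
    simpa using (hF x hx).fun_sub (hG x hx)
  have := constant_of_has_deriv_right_zero
    (fun x hx => (hd x hx.1).continuousAt.continuousWithinAt)
    (fun x hx => (hd x hx.1).hasDerivWithinAt) t ⟨ht, le_rfl⟩
  linarith

theorem abs_sub_le_of_hasDerivAt {F f : ℝ → ℝ} {a b C : ℝ} (hab : a ≤ b)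
    (hF : ∀ t, HasDerivAt F (f t) t) (hf : ∀ t ∈ Set.Icc a b, |f t| ≤ C) :
    |F b - F a| ≤ C * (b - a) :=
  norm_image_sub_le_of_norm_deriv_le_segment' (fun x _ => (hF x).hasDerivWithinAt)
    (fun x hx => hf x (Set.Ico_subset_Icc_self hx)) b ⟨hab, le_rfl⟩

/-- A smooth convex function agreeing with `max 0 (t - p)` outside `(p - δ, p + δ)`. -/
theorem exists_smooth_hinge (p : ℝ) {δ : ℝ} (hδ : 0 < δ) :
    ∃ K k : ℝ → ℝ, ContDiff ℝ (⊤ : ℕ∞) K ∧ (∀ t, HasDerivAt K (k t) t) ∧ Monotone k ∧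
      (∀ t ≤ p - δ, K t = 0) ∧ ∀ t ≥ p + δ, K t = t - p := by
  obtain ⟨K, hK, hKd, hK0⟩ := exists_contDiff_antideriv_eq_zero (u := 0)
    Real.smoothTransition.contDiff fun t ht => Real.smoothTransition.zero_of_nonpos ht
  have hK1 : |K 1 - K 0| ≤ 1 * (1 - 0) := abs_sub_le_of_hasDerivAt zero_le_one hKd fun t _ => by
    rw [abs_of_nonneg (Real.smoothTransition.nonneg t)]
    exact Real.smoothTransition.le_one t
  have hKmono : Monotone K := monotone_of_deriv_nonneg (fun t => (hKd t).differentiableAt) fun t => by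
    rw [(hKd t).deriv]
    exact Real.smoothTransition.nonneg t
  have hKpos : K 0 ≤ K 1 := hKmono zero_le_one
  have hK00 : K 0 = 0 := hK0 0 le_rfl
  have hKle : K 1 ≤ 1 := by
    have := (abs_le.1 hK1).2
    linarith
  have hKaff : ∀ t ≥ 1, K t = t - (1 - K 1) := fun t ht => by
    have := sub_eq_sub_of_hasDerivAt_Ici (G := fun x => x) (fun t _ => hKd t)
      (fun t ht => by rw [Real.smoothTransition.one_of_one_le ht]; exact hasDerivAt_id t) ht
    linarith
  set s := p - δ * (1 - K 1) with hs
  refine ⟨fun t => δ * K ((t - s) / δ), fun t => Real.smoothTransition ((t - s) / δ),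
    by fun_prop, fun t => ?_, fun x y hxy => Real.smoothTransition.monotone (by gcongr),
    fun t ht => ?_, fun t ht => ?_⟩
  · have h1 : HasDerivAt (fun t => (t - s) / δ) (1 / δ) t :=
      ((hasDerivAt_id t).sub_const s).div_const δ
    refine (((hKd _).comp t h1).const_mul δ).congr_deriv ?_
    field_simp
  · have : (t - s) / δ ≤ 0 := div_nonpos_of_nonpos_of_nonneg (by nlinarith) hδ.le
    simp [hK0 _ this]
  · have : 1 ≤ (t - s) / δ := by
      rw [le_div_iff₀ hδ]
      nlinarith
    simp only [hKaff _ this]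
    field_simp
    rw [hs]
    ring

/-- A smooth convex function vanishing on `(-∞, 0]` that differs on `[t₀, ∞)` from the deviation
of `g` from its tangent line at `t₀` by an affine function with small coefficients. -/
theorem exists_smooth_convex_tail {t₀ : ℝ} (ht₀ : 0 < t₀) {g : ℝ → ℝ}
    (hg : ContDiff ℝ (⊤ : ℕ∞) g) (hg'' : ∀ t ≥ t₀, 0 < deriv (deriv g) t) {η : ℝ} (hη : 0 < η) :
    ∃ (G G' : ℝ → ℝ) (A B : ℝ), ContDiff ℝ (⊤ : ℕ∞) G ∧ (∀ t, HasDerivAt G (G' t) t) ∧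
      Monotone G' ∧ (∀ t ≤ 0, G t = 0) ∧ |A| < η ∧ |B| < η ∧
      ∀ t ≥ t₀, G t = g t - g t₀ - deriv g t₀ * (t - t₀) + A + B * (t - t₀) := by
  obtain ⟨hgd, hg1⟩ := contDiff_infty_iff_deriv.1 hg
  obtain ⟨hg1d, hg2⟩ := contDiff_infty_iff_deriv.1 hg1
  obtain ⟨M, hM⟩ := isCompact_Icc.exists_bound_of_continuousOn
    (s := Set.Icc 0 t₀) hg2.continuous.continuousOn
  have hM0 : 0 < M := lt_of_lt_of_le (hg'' t₀ le_rfl) ((le_abs_self _).trans (hM t₀ ⟨ht₀.le, le_rfl⟩))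
  obtain ⟨r, hr, hpos⟩ := Metric.eventually_nhds_iff.1
    (hg2.continuous.continuousAt.eventually (lt_mem_nhds (hg'' t₀ le_rfl)))
  obtain ⟨ε, hε, hεt, hεr, hεη, hε1⟩ :
      ∃ ε > 0, ε < t₀ ∧ ε < r ∧ M * ε < η ∧ ε < 1 := by
    obtain ⟨ε, hε, h⟩ := exists_between (show 0 < min (min t₀ r) (min (η / M) 1) by positivity)
    simp only [lt_min_iff, lt_div_iff₀ hM0] at h
    exact ⟨ε, hε, h.1.1, h.1.2, by linarith, h.2.2⟩
  set u := t₀ - ε with hu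
  set h : ℝ → ℝ := fun t => Real.smoothTransition ((t - u) / ε) * deriv (deriv g) t with hh
  have hh0 : ∀ t ≤ u, h t = 0 := fun t ht => by
    simp [hh, Real.smoothTransition.zero_of_nonpos
      (div_nonpos_of_nonpos_of_nonneg (sub_nonpos.2 ht) hε.le)]
  have hh1 : ∀ t ≥ t₀, h t = deriv (deriv g) t := fun t ht => by
    have : 1 ≤ (t - u) / ε := by
      rw [le_div_iff₀ hε]
      linarith
    simp [hh, Real.smoothTransition.one_of_one_le this]
  have hh_nonneg : ∀ t, 0 ≤ h t := fun t => by
    rcases le_total t u with htu | htu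
    · exact (hh0 t htu).ge
    · refine mul_nonneg (Real.smoothTransition.nonneg _) ?_
      rcases le_total t₀ t with htt | htt
      · exact (hg'' t htt).le
      · refine (hpos ?_).le
        rw [Real.dist_eq, abs_lt]
        constructor <;> linarith
  have hh_le : ∀ t ∈ Set.Icc u t₀, |h t| ≤ M := fun t ht => by
    rw [hh, abs_mul, abs_of_nonneg (Real.smoothTransition.nonneg _)]
    exact (mul_le_of_le_one_left (abs_nonneg _) (Real.smoothTransition.le_one _)).trans
      (hM t ⟨by linarith [ht.1], ht.2⟩)
  obtain ⟨G', hG', hG'd, hG'0⟩ := exists_contDiff_antideriv_eq_zero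
    (show ContDiff ℝ (⊤ : ℕ∞) h by fun_prop) hh0
  obtain ⟨G, hG, hGd, hG0⟩ := exists_contDiff_antideriv_eq_zero hG' hG'0
  have hG'_le : ∀ t ∈ Set.Icc u t₀, |G' t| ≤ M * ε := fun t ht => by
    have := abs_sub_le_of_hasDerivAt ht.1 hG'd fun x hx => hh_le x ⟨hx.1, hx.2.trans ht.2⟩
    rw [hG'0 u le_rfl, sub_zero] at this
    exact this.trans (by gcongr; linarith [ht.2])
  have hut : u ≤ t₀ := by linarith
  have hG_le := abs_sub_le_of_hasDerivAt hut hGd hG'_le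
  rw [hG0 u le_rfl, sub_zero, hu, sub_sub_cancel] at hG_le
  refine ⟨G, G', G t₀, G' t₀, hG, hGd,
    monotone_of_deriv_nonneg (fun t => (hG'd t).differentiableAt)
      (fun t => (hG'd t).deriv ▸ hh_nonneg t),
    fun t ht => hG0 t (by linarith), ?_, (hG'_le t₀ ⟨hut, le_rfl⟩).trans_lt hεη, fun t ht => ?_⟩
  · exact (hG_le.trans (mul_le_of_le_one_right (by positivity) hε1.le)).trans_lt hεη
  · have hslope : ∀ x ≥ t₀, G' x = deriv g x - deriv g t₀ + G' t₀ := fun x hx => by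
      have := sub_eq_sub_of_hasDerivAt_Ici (fun t _ => hG'd t)
        (fun t ht => by rw [hh1 t ht]; exact (hg1d t).hasDerivAt) hx
      linarith
    have := sub_eq_sub_of_hasDerivAt_Ici (fun t _ => hGd t)
      (G := fun t => g t + (G' t₀ - deriv g t₀) * t) (fun x hx => by
        refine ((hgd x).hasDerivAt.fun_add ((hasDerivAt_id' x).const_mul _)).congr_deriv ?_
        rw [hslope x hx]
        ring) ht
    linarith


/-- Smooth convex interpolation between the constant function `1` on `(-∞,0]` and a
smooth strictly convex profile `g` on `[t₀, ∞)`, possible when `(0,1)` lies strictly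
above the tangent line to `g` at `t₀`. -/
theorem smooth_convex_gluing (t₀ : ℝ) (ht₀ : 0 < t₀) (g : ℝ → ℝ)
    (hg : ContDiff ℝ (⊤ : ℕ∞) g)
    (hg'' : ∀ t ≥ t₀, deriv (deriv g) t > 0)
    (hg' : deriv g t₀ > 0) (hgt : g t₀ > 1)
    (htan : g t₀ - t₀ * deriv g t₀ < 1) :
    ∃ f : ℝ → ℝ, ContDiff ℝ (⊤ : ℕ∞) f ∧ (∀ t ≤ (0:ℝ), f t = 1) ∧
      (∀ t ≥ t₀, f t = g t) ∧ ∀ t : ℝ, deriv (deriv f) t ≥ 0 := by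
  set m := deriv g t₀
  obtain ⟨η, hη, hηm, hηg, hηt⟩ : ∃ η > 0, η < m ∧ η < g t₀ - 1 ∧
      η * (1 + t₀) < 1 - g t₀ + t₀ * m := by
    have hd : 0 < 1 - g t₀ + t₀ * m := by linarith
    have hc : 0 < g t₀ - 1 := by linarith
    obtain ⟨η, hη, h⟩ := exists_between
      (show 0 < min (min m (g t₀ - 1)) ((1 - g t₀ + t₀ * m) / (1 + t₀)) by positivity)
    simp only [lt_min_iff, lt_div_iff₀ (show 0 < 1 + t₀ by positivity)] at h
    exact ⟨η, hη, h.1.1, h.1.2, h.2⟩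
  obtain ⟨G, G', A, B, hG, hGd, hG', hG0, hA, hB, hGt⟩ :=
    exists_smooth_convex_tail ht₀ hg hg'' hη
  rw [abs_lt] at hA hB
  -- The hinge has slope `β`, and `p` is where the remaining affine part takes the value `1`.
  set β := m - B
  have hβ : 0 < β := by linarith
  set p := (1 - g t₀ + A + t₀ * β) / β with hp
  have hβp : β * p = 1 - g t₀ + A + t₀ * β := by
    rw [hp]
    field_simp
  have hp0 : 0 < p := div_pos (by nlinarith) hβ
  have hpt : p < t₀ := by
    rw [hp, div_lt_iff₀ hβ]
    linarith
  obtain ⟨δ, hδ, hδp⟩ := exists_between (lt_min hp0 (sub_pos.2 hpt))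
  rw [lt_min_iff] at hδp
  obtain ⟨K, k, hK, hKd, hk, hK0, hKt⟩ := exists_smooth_hinge p hδ
  have hf : deriv (fun t => 1 + G t + β * K t) = fun t => G' t + β * k t :=
    funext fun t => (((hGd t).const_add 1).fun_add ((hKd t).const_mul β)).deriv
  refine ⟨fun t => 1 + G t + β * K t, by fun_prop, fun t ht => ?_, fun t ht => ?_, fun t => ?_⟩
  · simp [hG0 t ht, hK0 t (by linarith)]
  · simp only [hGt t ht, hKt t (by linarith), mul_sub, hβp]
    ring
  · rw [hf]
    exact (hG'.add (hk.const_mul hβ.le)).deriv_nonneg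
end
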